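/- Let n ≥ 1, q > 1, and let μ be a probability measure on ℝⁿ with finite first moment, zero barycenter, and not supported on any affine hyperplane. Let ρ̄ be a minimizer of J(ρ) = F(ρ) + T(ρ,μ) over P_1(ℝⁿ), written (as is possible) as ρ̄ = φ^{−(n+q)}·dx for a convex, lower semicontinuous function φ: ℝⁿ → (0,+∞], and set Ω := {x : φ(x) < +∞}. Then φ(x) = +∞ for H^{n−1}-almost every x ∈ ∂Ω; equivalently, the pointwise representative φ^{−(n+q)} of the density of ρ̄ vanishes H^{n−1}-almost everywhere on ∂Ω. -/

import Mathlib

open MeasureTheory Topology Filter Set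
open scoped ENNReal RealInnerProductSpace

noncomputable section

abbrev En (n : ℕ) : Type := EuclideanSpace ℝ (Fin n)

/-- The positive part of an extended real number, as an element of `ℝ≥0∞`. -/
def posPartNN (x : EReal) : ℝ≥0∞ := if x = ⊤ then ⊤ else ENNReal.ofReal x.toReal

/-- The integral of an `EReal`-valued function, with values in `EReal`
(defined as the integral of the positive part minus that of the negative part). -/
def eInt {X : Type*} [MeasurableSpace X] (ρ : Measure X) (g : X → EReal) : EReal :=
  ((∫⁻ x, posPartNN (g x) ∂ρ : ℝ≥0∞) : EReal) - ((∫⁻ x, posPartNN (-(g x)) ∂ρ : ℝ≥0∞) : EReal)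

/-- Transport plans between `ρ` and `μ`. -/
def Plans {n : ℕ} (ρ μ : Measure (En n)) : Set (Measure (En n × En n)) :=
  {γ | IsProbabilityMeasure γ ∧ γ.map Prod.fst = ρ ∧ γ.map Prod.snd = μ}

/-- The maximal correlation functional `T(ρ,μ)`. -/
def Tcorr {n : ℕ} (ρ μ : Measure (En n)) : EReal :=
  ⨆ γ ∈ Plans ρ μ, eInt γ (fun p => ((⟪p.1, p.2⟫ : ℝ) : EReal))

/-- The local functional `F(ρ) = ∫ f(ρ^ac) dx` with `f(t) = -t^α/α`, `α = 1 - 1/(n+q)`. -/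
def Ffun (n : ℕ) (q : ℝ) (ρ : Measure (En n)) : EReal :=
  - ((∫⁻ x, ENNReal.ofReal
      ((ρ.rnDeriv volume x).toReal ^ (1 - 1/((n : ℝ) + q)) / (1 - 1/((n : ℝ) + q)))
      ∂volume : ℝ≥0∞) : EReal)

/-- The functional `J(ρ) = F(ρ) + T(ρ,μ)`. -/
def Jfun (n : ℕ) (q : ℝ) (μ ρ : Measure (En n)) : EReal := Ffun n q ρ + Tcorr ρ μ

/-- Finite first moment. -/
def P1 {n : ℕ} (ρ : Measure (En n)) : Prop := Integrable (fun x : En n => ‖x‖) ρ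

/-- `μ` is not supported on any affine hyperplane. -/
def NotHyperplane {n : ℕ} (μ : Measure (En n)) : Prop :=
  ∀ (e : En n) (ℓ : ℝ), e ≠ 0 → μ {x | ⟪x, e⟫ = ℓ} ≠ 1

/-- A convex, lower semicontinuous function with values in `ℝ ∪ {+∞}`,
convexity being expressed through the epigraph. -/
def ConvexLSC {n : ℕ} (u : En n → EReal) : Prop :=
  LowerSemicontinuous u ∧ Convex ℝ {p : En n × ℝ | u p.1 ≤ (p.2 : EReal)}

/-- A bounded set has a finite maximal separated subset, which is then a net. -/
theorem exists_finset_separated_cover {n : ℕ} {K : Set (En n)} (hK : Bornology.IsBounded K)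
    {ε : ℝ} (hε : 0 < ε) :
    ∃ S : Finset (En n), (S : Set (En n)) ⊆ K ∧
      (S : Set (En n)).Pairwise (fun x y => ε < dist x y) ∧
      K ⊆ ⋃ x : S, Metric.closedBall (x : En n) ε := by
  have hε2 : (Real.toNNReal (ε / 2)) ≠ 0 := by simpa using hε
  obtain ⟨N, -, hNf, hN⟩ :=
    Metric.exists_finite_isCover_of_isCompact_closure hε2 hK.isCompact_closure
  have h2 : 2 * Real.toNNReal (ε / 2) = Real.toNNReal ε := by
    rw [show ε = 2 * (ε / 2) by ring, Real.toNNReal_mul (by norm_num)]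
    simp
  have hpack : Metric.packingNumber (Real.toNNReal ε) K ≠ ⊤ := by
    rw [← h2]
    refine ((Metric.packingNumber_two_mul_le_externalCoveringNumber _ K).trans
      hN.externalCoveringNumber_le_encard |>.trans_lt ?_).ne
    exact Set.encard_lt_top_iff.2 hNf
  have hfin : (Metric.maximalSeparatedSet (Real.toNNReal ε) K).Finite := by
    rw [← Set.encard_ne_top_iff, Metric.encard_maximalSeparatedSet hpack]
    exact hpack
  refine ⟨hfin.toFinset, ?_, ?_, ?_⟩
  · rw [hfin.coe_toFinset]
    exact Metric.maximalSeparatedSet_subset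
  · rw [hfin.coe_toFinset]
    intro x hx y hy hxy
    have : _ < edist x y := Metric.isSeparated_maximalSeparatedSet hx hy hxy
    rw [edist_dist, ← ENNReal.ofReal.eq_1] at this
    exact (ENNReal.ofReal_lt_ofReal_iff_of_nonneg hε.le).1 this
  · have := Metric.isCover_iff_subset_iUnion_closedBall.1
      (Metric.isCover_maximalSeparatedSet hpack)
    intro x hx
    obtain ⟨y, hy, hxy⟩ := Set.mem_iUnion₂.1 (this hx)
    refine Set.mem_iUnion.2 ⟨⟨y, by simpa using hy⟩, ?_⟩
    simpa [hε.le] using hxy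

/-- Near a boundary point of a convex set lying in a convex subset `C`, the layer between the set
and the translate of `C` contains a ball of comparable size. -/
theorem ball_subset_layer {n : ℕ} {Ω C : Set (En n)}
    (hΩ : Convex ℝ Ω) (hC : Convex ℝ C) (hCΩ : C ⊆ Ω) {x₀ z : En n} {r : ℝ}
    (hball : Metric.ball z r ⊆ C) {x : En n} (hxΩ : x ∈ frontier Ω) (hxC : x ∈ C)
    (hx : x ∈ Metric.ball x₀ (r / 2)) {h : ℝ} (h0 : 0 < h) (h1 : h < 1) :
    Metric.ball (x + (h / 2) • (x₀ - z)) (h * r / 4) ⊆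
      {y | y ∉ Ω ∧ y - h • (x₀ - z) ∈ C} := by
  intro y hy
  rw [Metric.mem_ball, dist_eq_norm] at hx hy
  obtain ⟨w, rfl⟩ : ∃ w, y = x + (h / 2) • (x₀ - z) + w :=
    ⟨y - (x + (h / 2) • (x₀ - z)), by abel⟩
  rw [add_sub_cancel_left] at hy
  have hw : ‖(2 / h) • w‖ < r / 2 := by
    rw [norm_smul, Real.norm_of_nonneg (by positivity)]
    calc 2 / h * ‖w‖ < 2 / h * (h * r / 4) := by gcongr
      _ = r / 2 := by field_simp; ring
  constructor
  · intro hyΩ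
    have hz : z + (x - x₀) - (2 / h) • w ∈ interior Ω := by
      refine interior_maximal (hball.trans hCΩ) Metric.isOpen_ball ?_
      rw [Metric.mem_ball, dist_eq_norm, add_sub_assoc, add_sub_cancel_left]
      calc _ ≤ ‖x - x₀‖ + ‖(2 / h) • w‖ := norm_sub_le _ _
        _ < r := by linarith
    have := hΩ.combo_interior_self_mem_interior hz hyΩ
      (a := (h / 2) / (1 + h / 2)) (b := 1 / (1 + h / 2)) (by positivity) (by positivity)
      (by field_simp; ring)
    apply hxΩ.2
    convert this using 1
    have e : (1 + h / 2) ≠ 0 := by positivity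
    apply smul_right_injective _ e
    simp only [smul_add, smul_sub, smul_smul]
    match_scalars <;> field_simp <;> ring
  · have hz : z + (x - x₀) + (2 / h) • w ∈ C := by
      apply hball
      rw [Metric.mem_ball, dist_eq_norm, add_assoc, add_sub_cancel_left]
      calc _ ≤ ‖x - x₀‖ + ‖(2 / h) • w‖ := norm_add_le _ _
        _ < r := by linarith
    convert hC hz hxC (a := h / 2) (b := 1 - h / 2) (by positivity) (by linarith) (by ring) using 1
    simp only [smul_add, smul_sub, smul_smul, sub_smul, one_smul]
    match_scalars <;> field_simp <;> ring

/-- If the layers `{y ∉ Ω, y - h (x₀ - z) ∈ C}` have volume `o(h)`, then the part of the boundary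
of `Ω` lying in `C` near `x₀` is negligible for the Hausdorff measure of codimension one. -/
theorem hausdorffMeasure_eq_zero_of_volume_layer_le {n : ℕ} (hn : 1 ≤ n) {Ω C : Set (En n)}
    (hΩ : Convex ℝ Ω) (hC : Convex ℝ C) (hCΩ : C ⊆ Ω) {x₀ z : En n} {r : ℝ} (hr : 0 < r)
    (hball : Metric.ball z r ⊆ C) {K : Set (En n)} (hKΩ : K ⊆ frontier Ω) (hKC : K ⊆ C)
    (hK : K ⊆ Metric.ball x₀ (r / 2))
    (hV : ∀ ε > 0, ∃ δ > 0, ∀ h : ℝ, 0 < h → h < δ →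
      volume {y | y ∉ Ω ∧ y - h • (x₀ - z) ∈ C} ≤ ENNReal.ofReal (ε * h)) :
    Measure.hausdorffMeasure ((n : ℝ) - 1) K = 0 := by
  obtain ⟨m, rfl⟩ : ∃ m, n = m + 1 := ⟨n - 1, by omega⟩
  have hKb : Bornology.IsBounded K := Metric.isBounded_ball.subset hK
  set B : ℝ := (volume (Metric.ball (0 : En (m + 1)) 1)).toReal with hB
  have hBpos : 0 < B := ENNReal.toReal_pos (Metric.measure_ball_pos _ _ one_pos).ne'
    measure_ball_lt_top.ne
  have key : ∀ ε > 0, ∃ δ > 0, ∀ h : ℝ, 0 < h → h < δ → ∃ S : Finset (En (m + 1)),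
      K ⊆ ⋃ x : S, Metric.closedBall (x : En (m + 1)) (h * r / 2) ∧
      (S.card : ℝ) * (h * r) ^ m ≤ ε := by
    intro ε hε
    obtain ⟨δ, hδ, hδV⟩ := hV (ε * (r * B / 4 ^ (m + 1))) (by positivity)
    refine ⟨min δ 1, by positivity, fun h h0 h1 => ?_⟩
    obtain ⟨S, hSK, hSsep, hScov⟩ := exists_finset_separated_cover hKb (ε := h * r / 2)
      (by positivity)
    refine ⟨S, hScov, ?_⟩
    have hle := hδV h h0 (h1.trans_le (min_le_left _ _))
    have hdisj : (S : Set (En (m + 1))).PairwiseDisjoint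
        (fun x => Metric.ball (x + (h / 2) • (x₀ - z)) (h * r / 4)) := by
      intro x hx y hy hxy
      apply Metric.ball_disjoint_ball
      rw [dist_add_right]
      have := hSsep hx hy hxy
      linarith
    have hsub : (⋃ x ∈ S, Metric.ball (x + (h / 2) • (x₀ - z)) (h * r / 4)) ⊆
        {y | y ∉ Ω ∧ y - h • (x₀ - z) ∈ C} := by
      refine Set.iUnion₂_subset fun x hx => ?_
      exact ball_subset_layer hΩ hC hCΩ hball (hKΩ (hSK hx)) (hKC (hSK hx)) (hK (hSK hx)) h0
        (h1.trans_le (min_le_right _ _))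
    have hvol : ∀ x : En (m + 1), volume (Metric.ball x (h * r / 4)) =
        ENNReal.ofReal ((h * r / 4) ^ (m + 1) * B) := by
      intro x
      rw [Measure.addHaar_ball_of_pos _ _ (by positivity), finrank_euclideanSpace_fin,
        ENNReal.ofReal_mul (by positivity), hB, ENNReal.ofReal_toReal measure_ball_lt_top.ne]
    have h2 := (measure_mono hsub).trans hle
    rw [measure_biUnion_finset hdisj (fun _ _ => Metric.isOpen_ball.measurableSet)] at h2
    simp only [hvol, Finset.sum_const, nsmul_eq_mul] at h2
    rw [← ENNReal.ofReal_natCast, ← ENNReal.ofReal_mul (by positivity),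
      ENNReal.ofReal_le_ofReal_iff (by positivity)] at h2
    have h3 : (h * r * B / 4 ^ (m + 1)) * (S.card * (h * r) ^ m) ≤
        (h * r * B / 4 ^ (m + 1)) * ε := by
      calc _ = S.card * ((h * r / 4) ^ (m + 1) * B) := by rw [div_pow]; field_simp; ring
        _ ≤ _ := h2
        _ = _ := by ring
    exact le_of_mul_le_mul_left h3 (by positivity)
  refine le_antisymm (ENNReal.le_of_forall_pos_le_add fun ε hε _ => ?_) bot_le
  rw [zero_add]
  obtain ⟨δ, hδ, hS⟩ := key ε hε
  have hh : ∀ k : ℕ, 0 < δ / (k + 2) ∧ δ / (k + 2) < δ := fun k =>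
    ⟨by positivity, div_lt_self hδ (by norm_cast; omega)⟩
  choose S hScov hScard using fun k : ℕ => hS (δ / (k + 2)) (hh k).1 (hh k).2
  have hd : ∀ (k : ℕ) (x : En (m + 1)),
      Metric.ediam (Metric.closedBall x (δ / (k + 2) * r / 2)) ≤
        ENNReal.ofReal (δ / (k + 2) * r) := by
    intro k x
    have := (hh k).1
    rw [← Metric.closedEBall_ofReal (by positivity)]
    refine Metric.ediam_closedEBall_le.trans_eq ?_
    rw [← ENNReal.ofReal_ofNat 2, ← ENNReal.ofReal_mul (by norm_num)]
    congr 1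
    ring
  refine (Measure.hausdorffMeasure_le_liminf_sum (ι := fun k => S k) _ K (l := atTop)
    (fun k : ℕ => ENNReal.ofReal (δ / (k + 2) * r)) ?_
    (fun k x => Metric.closedBall (x : En (m + 1)) (δ / (k + 2) * r / 2))
    (Eventually.of_forall fun k i => hd k i) (Eventually.of_forall hScov)).trans ?_
  · rw [← ENNReal.ofReal_zero]
    refine ENNReal.tendsto_ofReal ?_
    have : Tendsto (fun k : ℕ => δ / ((k : ℝ) + 2)) atTop (𝓝 0) :=
      Tendsto.const_div_atTop (tendsto_atTop_add_const_right _ _ tendsto_natCast_atTop_atTop) _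
    simpa using this.mul_const r
  · refine liminf_le_of_le (by isBoundedDefault) fun b hb => ?_
    obtain ⟨k, hk⟩ := hb.exists
    refine hk.trans ?_
    have : (((m + 1 : ℕ) : ℝ) - 1) = (m : ℝ) := by push_cast; ring
    rw [this]
    calc ∑ x : S k, Metric.ediam (Metric.closedBall (x : En (m + 1)) (δ / (k + 2) * r / 2)) ^ (m : ℝ)
        ≤ ∑ _x : S k, ENNReal.ofReal (δ / (k + 2) * r) ^ (m : ℝ) := by
          gcongr with x
          exact hd k x
      _ = ENNReal.ofReal ((S k).card * (δ / (k + 2) * r) ^ m) := by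
          rw [Finset.sum_const, Finset.card_univ, Fintype.card_coe, nsmul_eq_mul,
            ENNReal.rpow_natCast, ENNReal.ofReal_mul (Nat.cast_nonneg _), ENNReal.ofReal_natCast,
            ENNReal.ofReal_pow (by have := (hh k).1; positivity)]
      _ ≤ ENNReal.ofReal ε := ENNReal.ofReal_le_ofReal (hScard k)
      _ = ε := by simp

theorem posPartNN_coe (r : ℝ) : posPartNN (r : EReal) = ENNReal.ofReal r := by
  simp [posPartNN]

theorem eInt_coe {X : Type*} [MeasurableSpace X] (γ : Measure X) (g : X → ℝ) :
    eInt γ (fun x => (g x : EReal)) =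
      ((∫⁻ x, ENNReal.ofReal (g x) ∂γ : ℝ≥0∞) : EReal) -
        ((∫⁻ x, ENNReal.ofReal (-(g x)) ∂γ : ℝ≥0∞) : EReal) := by
  simp only [eInt, ← EReal.coe_neg, posPartNN_coe]

theorem eInt_coe_of_integrable {X : Type*} [MeasurableSpace X] {γ : Measure X} {g : X → ℝ}
    (hg : Integrable g γ) : eInt γ (fun x => (g x : EReal)) = ((∫ x, g x ∂γ : ℝ) : EReal) := by
  have h1 : ∫⁻ x, ENNReal.ofReal (g x) ∂γ ≠ ⊤ := hg.lintegral_lt_top.ne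
  have h2 : ∫⁻ x, ENNReal.ofReal (-(g x)) ∂γ ≠ ⊤ := hg.neg.lintegral_lt_top.ne
  rw [eInt_coe, integral_eq_lintegral_pos_part_sub_lintegral_neg_part hg, EReal.coe_sub,
    EReal.coe_ennreal_toReal h1, EReal.coe_ennreal_toReal h2]

/-- The average of a measure and of its translate by `v`. -/
def avgTranslate {n : ℕ} (ρ : Measure (En n)) (v : En n) : Measure (En n) :=
  (2⁻¹ : ℝ≥0∞) • ρ + (2⁻¹ : ℝ≥0∞) • ρ.map (· + v)

instance isProbabilityMeasure_avgTranslate {n : ℕ} (ρ : Measure (En n)) [IsProbabilityMeasure ρ]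
    (v : En n) : IsProbabilityMeasure (avgTranslate ρ v) := by
  have : IsProbabilityMeasure (ρ.map (· + v)) :=
    Measure.isProbabilityMeasure_map (by fun_prop)
  constructor
  simp [avgTranslate, ENNReal.inv_two_add_inv_two]

theorem P1.avgTranslate {n : ℕ} {ρ : Measure (En n)} [IsProbabilityMeasure ρ] (hρ : P1 ρ)
    (v : En n) : P1 (avgTranslate ρ v) := by
  refine Integrable.add_measure (hρ.smul_measure (by simp)) (Integrable.smul_measure ?_ (by simp))
  rw [integrable_map_measure (by fun_prop) (by fun_prop)]
  refine Integrable.mono' (Integrable.add hρ (integrable_const ‖v‖)) (by fun_prop)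
    (Eventually.of_forall fun x => ?_)
  simpa using norm_add_le x v

theorem map_add_right_withDensity {n : ℕ} (f : En n → ℝ≥0∞) (v : En n) :
    (volume.withDensity f).map (· + v) = volume.withDensity (fun x => f (x - v)) := by
  ext s hs
  have hs' : MeasurableSet ((· + v) ⁻¹' s) := (measurable_add_const v) hs
  rw [Measure.map_apply (by fun_prop) hs, withDensity_apply _ hs', withDensity_apply _ hs,
    ← lintegral_indicator hs', ← lintegral_indicator hs,
    ← lintegral_add_right_eq_self (fun x => s.indicator (fun x => f (x - v)) x) v]
  refine lintegral_congr fun x => ?_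
  simp only [Set.indicator, add_sub_cancel_right]
  rfl

theorem avgTranslate_withDensity {n : ℕ} {p : En n → NNReal} (hp : Measurable p) (v : En n) :
    avgTranslate (volume.withDensity fun x => (p x : ℝ≥0∞)) v =
      volume.withDensity (fun x => (((p x + p (x - v)) / 2 : NNReal) : ℝ≥0∞)) := by
  rw [avgTranslate, map_add_right_withDensity, ← withDensity_smul _ (by fun_prop),
    ← withDensity_smul _ (by fun_prop), ← withDensity_add_left (by fun_prop)]
  congr 1
  ext x
  simp only [Pi.add_apply, Pi.smul_apply, smul_eq_mul]
  rw [ENNReal.coe_div (by norm_num), ENNReal.coe_add, ENNReal.div_eq_inv_mul, mul_add]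
  rfl

/-- Translation is continuous in `L¹`. -/
theorem tendsto_integral_abs_sub_translate {n : ℕ} {f : En n → ℝ} (hf : Integrable f) :
    Tendsto (fun v : En n => ∫ x, |f (x - v) - f x|) (𝓝 0) (𝓝 0) := by
  have hf' : MemLp f 1 volume := memLp_one_iff_integrable.2 hf
  let g : En n → C(En n, En n) := fun v => ⟨fun x => x - v, by fun_prop⟩
  have hg : Continuous g := ContinuousMap.continuous_of_continuous_uncurry _ (by
    show Continuous fun q : En n × En n => q.2 - q.1
    fun_prop)
  have hgm : ∀ v, MeasurePreserving (g v) volume volume := fun v =>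
    measurePreserving_sub_right volume v
  have h := (continuous_const (y := hf'.toLp f)).compMeasurePreservingLp hg hgm (by simp)
  have h0 := (h.sub (continuous_const (y := hf'.toLp f))).norm.tendsto 0
  have e : ∀ v, ‖Lp.compMeasurePreserving (g v) (hgm v) (hf'.toLp f) - hf'.toLp f‖ =
      ∫ x, |f (x - v) - f x| := by
    intro v
    rw [L1.norm_eq_integral_norm]
    refine integral_congr_ae ?_
    filter_upwards [Lp.coeFn_sub (Lp.compMeasurePreserving (g v) (hgm v) (hf'.toLp f)) (hf'.toLp f),
      Lp.coeFn_compMeasurePreserving (hf'.toLp f) (hgm v),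
      (hgm v).quasiMeasurePreserving.ae hf'.coeFn_toLp, hf'.coeFn_toLp] with x h1 h2 h3 h4
    rw [h1, Pi.sub_apply, h2, Function.comp_apply, h3, h4]
    rfl
  have h1 := h0.congr e
  have hz : Lp.compMeasurePreserving (g 0) (hgm 0) (hf'.toLp f) - hf'.toLp f = 0 := by
    rw [← norm_eq_zero, e]
    simp
  simpa [hz] using h1

/-- The plan obtained from `γ` by translating its first coordinate by `-v` on the fraction
`1 - a` of the mass. -/
def pullbackPlan {n : ℕ} (γ : Measure (En n × En n)) (a : En n → NNReal) (v : En n) :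
    Measure (En n × En n) :=
  γ.withDensity (fun p => (a p.1 : ℝ≥0∞)) +
    (γ.withDensity (fun p => ((1 - a p.1 : NNReal) : ℝ≥0∞))).map (fun p => (p.1 - v, p.2))

theorem withDensity_add_withDensity_one_sub {X : Type*} [MeasurableSpace X] (γ : Measure X)
    {a : X → NNReal} (ha : Measurable a) (ha1 : ∀ x, a x ≤ 1) :
    γ.withDensity (fun x => (a x : ℝ≥0∞)) +
      γ.withDensity (fun x => ((1 - a x : NNReal) : ℝ≥0∞)) = γ := by
  rw [← withDensity_add_left (by fun_prop)]
  convert withDensity_one using 2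
  ext x
  simp only [Pi.add_apply, Pi.one_apply]
  rw [← ENNReal.coe_add, add_tsub_cancel_of_le (ha1 x), ENNReal.coe_one]

theorem map_fst_withDensity {n : ℕ} (γ : Measure (En n × En n)) {f : En n → ℝ≥0∞}
    (hf : Measurable f) :
    (γ.withDensity (fun p => f p.1)).map Prod.fst = (γ.map Prod.fst).withDensity f := by
  ext s hs
  rw [Measure.map_apply measurable_fst hs, withDensity_apply _ (measurable_fst hs),
    withDensity_apply _ hs, setLIntegral_map hs hf measurable_fst]

theorem pullbackPlan_mem_Plans {n : ℕ} {ρ μ : Measure (En n)} [IsProbabilityMeasure μ]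
    {v : En n} {γ : Measure (En n × En n)}
    (hγ : γ ∈ Plans (avgTranslate ρ v) μ) {a : En n → NNReal} (ha : Measurable a)
    (ha1 : ∀ x, a x ≤ 1)
    (hA : (avgTranslate ρ v).withDensity (fun x => (a x : ℝ≥0∞)) = (2⁻¹ : ℝ≥0∞) • ρ)
    (hB : (avgTranslate ρ v).withDensity (fun x => ((1 - a x : NNReal) : ℝ≥0∞)) =
      (2⁻¹ : ℝ≥0∞) • ρ.map (· + v)) :
    pullbackPlan γ a v ∈ Plans ρ μ := by
  obtain ⟨hγp, hγ1, hγ2⟩ := hγ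
  have hsnd : (pullbackPlan γ a v).map Prod.snd = μ := by
    rw [pullbackPlan, Measure.map_add _ _ measurable_snd,
      Measure.map_map measurable_snd (by fun_prop)]
    have : (Prod.snd ∘ fun p : En n × En n => (p.1 - v, p.2)) = Prod.snd := rfl
    rw [this, ← Measure.map_add _ _ measurable_snd,
      withDensity_add_withDensity_one_sub γ (a := fun p => a p.1) (by fun_prop) (fun _ => ha1 _),
      hγ2]
  refine ⟨⟨?_⟩, ?_, hsnd⟩
  · rw [← Set.preimage_univ (f := Prod.snd), ← Measure.map_apply measurable_snd .univ, hsnd,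
      measure_univ]
  · rw [pullbackPlan, Measure.map_add _ _ measurable_fst,
      Measure.map_map measurable_fst (by fun_prop)]
    have : (Prod.fst ∘ fun p : En n × En n => (p.1 - v, p.2)) = (· - v) ∘ Prod.fst := rfl
    rw [this, ← Measure.map_map (by fun_prop) measurable_fst,
      map_fst_withDensity γ (f := fun x => (a x : ℝ≥0∞)) (by fun_prop),
      map_fst_withDensity γ (f := fun x => ((1 - a x : NNReal) : ℝ≥0∞)) (by fun_prop),
      hγ1, hA, hB, Measure.map_smul, Measure.map_map (by fun_prop) (by fun_prop)]
    have : ((· - v) ∘ (· + v)) = (id : En n → En n) := by ext; simp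
    rw [this, Measure.map_id, ← add_smul, ENNReal.inv_two_add_inv_two, one_smul]

theorem eInt_inner_le_of_pullbackPlan {n : ℕ} {γ : Measure (En n × En n)}
    {v : En n} {a : En n → NNReal} (ha : Measurable a) (ha1 : ∀ x, a x ≤ 1)
    (hy : Integrable (fun p : En n × En n => ‖p.2‖) γ) {T : EReal} (hT : T ≠ ⊤)
    (hle : eInt (pullbackPlan γ a v) (fun p => ((⟪p.1, p.2⟫ : ℝ) : EReal)) ≤ T) :
    eInt γ (fun p => ((⟪p.1, p.2⟫ : ℝ) : EReal)) ≤
      T + ((∫ p, (1 - (a p.1 : ℝ)) * ⟪v, p.2⟫ ∂γ : ℝ) : EReal) := by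
  set A := γ.withDensity (fun p => (a p.1 : ℝ≥0∞)) with hAdef
  set B := γ.withDensity (fun p => ((1 - a p.1 : NNReal) : ℝ≥0∞)) with hBdef
  have hAB : A + B = γ :=
    withDensity_add_withDensity_one_sub γ (a := fun p => a p.1) (by fun_prop) (fun _ => ha1 _)
  have hBγ : B ≤ γ := by rw [← hAB]; exact Measure.le_add_left le_rfl
  have hvy : Integrable (fun p : En n × En n => ⟪v, p.2⟫) γ := by
    refine Integrable.mono' (hy.const_mul ‖v‖) (by fun_prop) (Eventually.of_forall fun p => ?_)
    exact norm_inner_le_norm _ _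
  have hmap : Measurable (fun p : En n × En n => (p.1 - v, p.2)) := by fun_prop
  have hsplit : ∀ f : En n × En n → ℝ≥0∞, Measurable f → ∫⁻ p, f p ∂(pullbackPlan γ a v) =
      ∫⁻ p, f p ∂A + ∫⁻ p, f (p.1 - v, p.2) ∂B := by
    intro f hf
    rw [pullbackPlan, lintegral_add_measure, lintegral_map hf hmap]
  have hfin : ∫⁻ p : En n × En n, ENNReal.ofReal |⟪v, p.2⟫| ∂B ≠ ⊤ :=
    (hvy.abs.mono_measure hBγ).lintegral_lt_top.ne
  by_cases hN : ∫⁻ p : En n × En n, ENNReal.ofReal (-⟪p.1, p.2⟫) ∂γ = ⊤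
  · rw [eInt_coe, hN]
    simp [EReal.sub_top]
  have hNA : ∫⁻ p : En n × En n, ENNReal.ofReal (-⟪p.1, p.2⟫) ∂(pullbackPlan γ a v) ≠ ⊤ := by
    rw [← hAB, lintegral_add_measure, ENNReal.add_eq_top, not_or] at hN
    rw [hsplit _ (by fun_prop), ENNReal.add_ne_top]
    refine ⟨hN.1, ne_top_of_le_ne_top (ENNReal.add_ne_top.2 ⟨hN.2, hfin⟩) ?_⟩
    rw [← lintegral_add_left (by fun_prop)]
    refine lintegral_mono fun p => (ENNReal.ofReal_le_ofReal ?_).trans ENNReal.ofReal_add_le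
    rw [inner_sub_left]
    linarith [le_abs_self ⟪v, p.2⟫]
  have hPA : ∫⁻ p : En n × En n, ENNReal.ofReal ⟪p.1, p.2⟫ ∂(pullbackPlan γ a v) ≠ ⊤ := by
    intro h
    rw [eInt_coe, h, EReal.coe_ennreal_top, EReal.top_sub (by simpa using hNA), top_le_iff] at hle
    exact hT hle
  have hint : Integrable (fun p : En n × En n => ⟪p.1, p.2⟫) (pullbackPlan γ a v) := by
    refine ⟨by fun_prop, ?_⟩
    rw [hasFiniteIntegral_iff_norm]
    refine lt_of_le_of_lt ?_ (ENNReal.add_lt_top.2 ⟨hPA.lt_top, hNA.lt_top⟩)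
    rw [← lintegral_add_left (by fun_prop)]
    refine lintegral_mono fun p => ?_
    rcases le_total 0 ⟪p.1, p.2⟫ with h | h
    · rw [Real.norm_of_nonneg h]; exact le_self_add
    · rw [Real.norm_of_nonpos h]; exact le_add_self
  obtain ⟨hintA, hintB⟩ := integrable_add_measure.1 hint
  rw [integrable_map_measure (by fun_prop) (by fun_prop)] at hintB
  have hvyB := hvy.mono_measure hBγ
  have hintB' : Integrable (fun p : En n × En n => ⟪p.1, p.2⟫) B := by
    refine (hintB.add hvyB).congr (Eventually.of_forall fun p => ?_)
    simp [inner_sub_left]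
  have hintγ : Integrable (fun p : En n × En n => ⟪p.1, p.2⟫) γ := by
    rw [← hAB]; exact hintA.add_measure hintB'
  have heq : ∫ p, ⟪p.1, p.2⟫ ∂γ = ∫ p, ⟪p.1, p.2⟫ ∂(pullbackPlan γ a v) +
      ∫ p, (1 - (a p.1 : ℝ)) * ⟪v, p.2⟫ ∂γ := by
    have h1 : ∫ p, (1 - (a p.1 : ℝ)) * ⟪v, p.2⟫ ∂γ = ∫ p, ⟪v, p.2⟫ ∂B := by
      rw [hBdef, integral_withDensity_eq_integral_smul (by fun_prop)]
      refine integral_congr_ae (Eventually.of_forall fun p => ?_)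
      simp [NNReal.smul_def, NNReal.coe_sub (ha1 p.1)]
    have h2 : ∫ p, ⟪p.1, p.2⟫ ∂(pullbackPlan γ a v) =
        ∫ p, ⟪p.1, p.2⟫ ∂A + ∫ p, (⟪p.1, p.2⟫ - ⟪v, p.2⟫) ∂B := by
      rw [pullbackPlan, integral_add_measure hintA (integrable_add_measure.1 hint).2,
        integral_map (by fun_prop) (by fun_prop)]
      simp only [inner_sub_left]
      rfl
    rw [h1, h2, integral_sub hintB' hvyB]
    conv_lhs => rw [← hAB]
    rw [integral_add_measure hintA hintB']
    ring
  rw [eInt_coe_of_integrable hint] at hle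
  rw [eInt_coe_of_integrable hintγ, heq, EReal.coe_add]
  gcongr

/-- The fraction of the mass of the averaged density at `x` that has not been translated. -/
def stayFraction {n : ℕ} (p : En n → NNReal) (v x : En n) : NNReal := p x / (p x + p (x - v))

theorem measurable_stayFraction {n : ℕ} {p : En n → NNReal} (hp : Measurable p) (v : En n) :
    Measurable (stayFraction p v) := by
  unfold stayFraction
  fun_prop

theorem stayFraction_le_one {n : ℕ} (p : En n → NNReal) (v x : En n) : stayFraction p v x ≤ 1 :=
  div_le_one_of_le₀ le_self_add (by positivity)

theorem half_add_mul_stayFraction {n : ℕ} (p : En n → NNReal) (v x : En n) :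
    (p x + p (x - v)) / 2 * stayFraction p v x = p x / 2 := by
  unfold stayFraction
  rcases eq_or_ne (p x + p (x - v)) 0 with h | h
  · simp [(add_eq_zero.1 h).1]
  · field_simp

theorem half_add_mul_one_sub_stayFraction {n : ℕ} (p : En n → NNReal) (v x : En n) :
    (p x + p (x - v)) / 2 * (1 - stayFraction p v x) = p (x - v) / 2 := by
  rw [mul_tsub, half_add_mul_stayFraction, mul_one, add_div, add_tsub_cancel_left]

theorem withDensity_stayFraction {n : ℕ} {p : En n → NNReal} (hp : Measurable p) (v : En n) :
    (avgTranslate (volume.withDensity fun x => (p x : ℝ≥0∞)) v).withDensity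
      (fun x => (stayFraction p v x : ℝ≥0∞)) =
      (2⁻¹ : ℝ≥0∞) • volume.withDensity fun x => (p x : ℝ≥0∞) := by
  have := measurable_stayFraction hp v
  rw [avgTranslate_withDensity hp, ← withDensity_mul _ (by fun_prop) (by fun_prop),
    ← withDensity_smul _ (by fun_prop)]
  congr 1
  ext x
  simp only [Pi.mul_apply, Pi.smul_apply, smul_eq_mul]
  rw [← ENNReal.coe_mul, half_add_mul_stayFraction, ENNReal.coe_div (by norm_num),
    ENNReal.div_eq_inv_mul]
  rfl

theorem withDensity_one_sub_stayFraction {n : ℕ} {p : En n → NNReal} (hp : Measurable p)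
    (v : En n) :
    (avgTranslate (volume.withDensity fun x => (p x : ℝ≥0∞)) v).withDensity
      (fun x => ((1 - stayFraction p v x : NNReal) : ℝ≥0∞)) =
      (2⁻¹ : ℝ≥0∞) • (volume.withDensity fun x => (p x : ℝ≥0∞)).map (· + v) := by
  have := measurable_stayFraction hp v
  rw [avgTranslate_withDensity hp, ← withDensity_mul _ (by fun_prop) (by fun_prop),
    map_add_right_withDensity, ← withDensity_smul _ (by fun_prop)]
  congr 1
  ext x
  simp only [Pi.mul_apply, Pi.smul_apply, smul_eq_mul]
  rw [← ENNReal.coe_mul, half_add_mul_one_sub_stayFraction, ENNReal.coe_div (by norm_num),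
    ENNReal.div_eq_inv_mul]
  rfl

theorem integral_abs_stayFraction_sub_half {n : ℕ} {p : En n → NNReal} (hp : Measurable p)
    (v : En n) :
    ∫ x, |1 / 2 - (stayFraction p v x : ℝ)| ∂(avgTranslate (volume.withDensity
      fun x => (p x : ℝ≥0∞)) v) = (∫ x, |(p (x - v) : ℝ) - p x|) / 4 := by
  rw [avgTranslate_withDensity hp, integral_withDensity_eq_integral_smul (by fun_prop),
    ← integral_div]
  refine integral_congr_ae (Eventually.of_forall fun x => ?_)
  have h := congrArg NNReal.toReal (half_add_mul_stayFraction p v x)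
  push_cast at h
  simp only [NNReal.smul_def, smul_eq_mul]
  push_cast
  rw [← abs_of_nonneg (show (0 : ℝ) ≤ (p x + p (x - v)) / 2 by positivity), ← abs_mul,
    ← abs_of_nonneg (show (0 : ℝ) ≤ 4 by norm_num), ← abs_div]
  congr 1
  rw [mul_sub, h]
  ring

theorem exists_integral_max_norm_sub_lt {n : ℕ} {μ : Measure (En n)} (hμ : P1 μ)
    {ε : ℝ} (hε : 0 < ε) : ∃ R : ℕ, ∫ y, max (‖y‖ - R) 0 ∂μ < ε := by
  have : Tendsto (fun R : ℕ => ∫ y, max (‖y‖ - R) 0 ∂μ) atTop (𝓝 (∫ _y, (0 : ℝ) ∂μ)) := by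
    refine tendsto_integral_of_dominated_convergence (fun y => ‖y‖) (fun R => by fun_prop) hμ
      (fun R => Eventually.of_forall fun y => ?_) (Eventually.of_forall fun y => ?_)
    · rw [Real.norm_of_nonneg (le_max_right _ _)]
      exact max_le (by linarith [(Nat.cast_nonneg R : (0 : ℝ) ≤ R)]) (norm_nonneg _)
    · refine tendsto_const_nhds.congr' ?_
      obtain ⟨N, hN⟩ := exists_nat_ge ‖y‖
      filter_upwards [eventually_ge_atTop N] with R hR
      have : (N : ℝ) ≤ R := by exact_mod_cast hR
      rw [max_eq_right (by linarith)]
  rw [integral_zero] at this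
  exact (this.eventually (gt_mem_nhds hε)).exists

/-- Averaging a density with its translate by `v` increases the maximal correlation with a centered
measure by at most `o(‖v‖)`. -/
theorem Tcorr_avgTranslate_le {n : ℕ} {μ : Measure (En n)} [IsProbabilityMeasure μ] (hμ : P1 μ)
    (hbar : ∫ y, y ∂μ = (0 : En n)) {p : En n → NNReal} (hp : Measurable p)
    [IsProbabilityMeasure (volume.withDensity fun x => (p x : ℝ≥0∞))]
    (hT : Tcorr (volume.withDensity fun x => (p x : ℝ≥0∞)) μ ≠ ⊤) {ε : ℝ} (hε : 0 < ε) :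
    ∃ δ > 0, ∀ v : En n, ‖v‖ < δ →
      Tcorr (avgTranslate (volume.withDensity fun x => (p x : ℝ≥0∞)) v) μ ≤
        Tcorr (volume.withDensity fun x => (p x : ℝ≥0∞)) μ + ((ε * ‖v‖ : ℝ) : EReal) := by
  set ρ : Measure (En n) := volume.withDensity fun x => (p x : ℝ≥0∞) with hρ
  obtain ⟨R, hR⟩ := exists_integral_max_norm_sub_lt hμ (half_pos hε)
  have hpint : Integrable (fun x => (p x : ℝ)) := by
    refine ⟨by fun_prop, ?_⟩
    have h1 : ∫⁻ x, (p x : ℝ≥0∞) = 1 := by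
      rw [← setLIntegral_univ, ← withDensity_apply _ .univ, measure_univ]
    simp [hasFiniteIntegral_iff_enorm, h1]
  have hcont := tendsto_integral_abs_sub_translate hpint
  obtain ⟨δ, hδ, hδ'⟩ := Metric.eventually_nhds_iff.1
    ((hcont.mul_const (R : ℝ)).eventually_lt_const (u := ε / 2) (by simpa using hε))
  refine ⟨δ, hδ, fun v hv => ?_⟩
  have hv' := hδ' (y := v) (by simpa using hv)
  have hmeas := measurable_stayFraction hp v
  refine iSup₂_le fun γ hγ => ?_
  obtain ⟨hγp, hγ1, hγ2⟩ := id hγ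
  have hy : Integrable (fun q : En n × En n => ‖q.2‖) γ := by
    have : Integrable (fun y : En n => ‖y‖) (γ.map Prod.snd) := by rw [hγ2]; exact hμ
    exact this.comp_measurable measurable_snd
  have hy' : Integrable (fun y : En n => y) μ :=
    (integrable_norm_iff (by fun_prop)).1 hμ
  have hvy : Integrable (fun q : En n × En n => ⟪v, q.2⟫) γ := by
    refine Integrable.mono' (hy.const_mul ‖v‖) (by fun_prop) (Eventually.of_forall fun p => ?_)
    exact norm_inner_le_norm _ _
  have h0 : ∫ q, ⟪v, q.2⟫ ∂γ = 0 := by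
    have : ∫ q, ⟪v, q.2⟫ ∂γ = ∫ y, ⟪v, y⟫ ∂μ := by
      rw [← hγ2, integral_map (by fun_prop) (by fun_prop)]
    rw [this, integral_inner hy', hbar, inner_zero_right]
  refine (eInt_inner_le_of_pullbackPlan hmeas (stayFraction_le_one p v) hy hT
    (le_iSup₂_of_le _ (pullbackPlan_mem_Plans hγ hmeas (stayFraction_le_one p v)
      (withDensity_stayFraction hp v) (withDensity_one_sub_stayFraction hp v)) le_rfl)).trans ?_
  gcongr
  have hc : ∀ x, |1 / 2 - (stayFraction p v x : ℝ)| ≤ 1 := fun x => by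
    have h1 : (stayFraction p v x : ℝ) ≤ 1 := by exact_mod_cast stayFraction_le_one p v x
    have h2 := (stayFraction p v x).coe_nonneg
    rw [abs_le]
    constructor <;> linarith
  have hint1 : Integrable (fun q : En n × En n => |1 / 2 - (stayFraction p v q.1 : ℝ)|) γ :=
    Integrable.of_bound (Measurable.aestronglyMeasurable (by fun_prop)) 1
      (Eventually.of_forall fun q => by simpa using hc q.1)
  have hint2 : Integrable (fun q : En n × En n => max (‖q.2‖ - R) 0) γ := by
    refine Integrable.mono' hy (by fun_prop) (Eventually.of_forall fun q => ?_)
    rw [Real.norm_of_nonneg (le_max_right _ _)]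
    exact max_le (by linarith [(Nat.cast_nonneg R : (0 : ℝ) ≤ R)]) (norm_nonneg _)
  have hint3 : Integrable (fun q : En n × En n =>
      (1 / 2 - (stayFraction p v q.1 : ℝ)) * ⟪v, q.2⟫) γ :=
    hvy.bdd_mul (c := 1) (Measurable.aestronglyMeasurable (by fun_prop))
      (Eventually.of_forall fun q => by simpa using hc q.1)
  have e1 : ∫ q, (1 - (stayFraction p v q.1 : ℝ)) * ⟪v, q.2⟫ ∂γ =
      ∫ q, (1 / 2 - (stayFraction p v q.1 : ℝ)) * ⟪v, q.2⟫ ∂γ := by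
    have : ∀ q : En n × En n, (1 - (stayFraction p v q.1 : ℝ)) * ⟪v, q.2⟫ =
        (1 / 2 - (stayFraction p v q.1 : ℝ)) * ⟪v, q.2⟫ + 1 / 2 * ⟪v, q.2⟫ := fun q => by ring
    simp only [this]
    rw [integral_add hint3 (hvy.const_mul _), integral_const_mul, h0]
    ring
  have e2 : ∫ q, |1 / 2 - (stayFraction p v q.1 : ℝ)| ∂γ =
      (∫ x, |(p (x - v) : ℝ) - p x|) / 4 := by
    rw [← integral_abs_stayFraction_sub_half hp v, ← hρ, ← hγ1,
      integral_map (by fun_prop) (by fun_prop)]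
  have e3 : ∫ q, max (‖q.2‖ - R) 0 ∂γ = ∫ y, max (‖y‖ - R) 0 ∂μ := by
    rw [← hγ2, integral_map (by fun_prop) (by fun_prop)]
  rw [e1]
  calc ∫ q, (1 / 2 - (stayFraction p v q.1 : ℝ)) * ⟪v, q.2⟫ ∂γ
      ≤ ∫ q, ‖v‖ * (R * |1 / 2 - (stayFraction p v q.1 : ℝ)| + max (‖q.2‖ - R) 0) ∂γ := by
        refine integral_mono hint3 (((hint1.const_mul _).add hint2).const_mul _) fun q => ?_
        refine (le_abs_self _).trans ?_
        rw [abs_mul]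
        have h1 := abs_real_inner_le_norm v q.2
        have h2 := hc q.1
        have h3 : ‖q.2‖ ≤ R + max (‖q.2‖ - R) 0 := by linarith [le_max_left (‖q.2‖ - R) 0]
        calc |1 / 2 - (stayFraction p v q.1 : ℝ)| * |⟪v, q.2⟫|
            ≤ |1 / 2 - (stayFraction p v q.1 : ℝ)| * (‖v‖ * (R + max (‖q.2‖ - R) 0)) := by
              gcongr
              exact h1.trans (by gcongr)
          _ = ‖v‖ * (R * |1 / 2 - (stayFraction p v q.1 : ℝ)| +
              |1 / 2 - (stayFraction p v q.1 : ℝ)| * max (‖q.2‖ - R) 0) := by ring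
          _ ≤ _ := by
              gcongr
              exact mul_le_of_le_one_left (le_max_right _ _) h2
    _ = ‖v‖ * ((∫ x, |(p (x - v) : ℝ) - p x|) * R / 4 + ∫ y, max (‖y‖ - R) 0 ∂μ) := by
        rw [integral_const_mul, integral_add (hint1.const_mul _) hint2, integral_const_mul, e2, e3]
        ring
    _ ≤ ε * ‖v‖ := by
        rw [mul_comm]
        gcongr
        have : 0 ≤ (∫ x, |(p (x - v) : ℝ) - p x|) * R := by positivity
        linarith

theorem Ffun_withDensity {n : ℕ} (q : ℝ) {p : En n → NNReal} (hp : Measurable p) :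
    Ffun n q (volume.withDensity fun x => (p x : ℝ≥0∞)) =
      -((∫⁻ x, ENNReal.ofReal ((p x : ℝ) ^ (1 - 1/((n : ℝ) + q)) / (1 - 1/((n : ℝ) + q)))
        : ℝ≥0∞) : EReal) := by
  unfold Ffun
  congr 2
  refine lintegral_congr_ae ?_
  filter_upwards [Measure.rnDeriv_withDensity volume (f := fun x => (p x : ℝ≥0∞))
    (by fun_prop)] with x hx
  rw [hx, ENNReal.coe_toReal]

/-- A density with finite first moment has a finite power integral for the exponent
`1 - 1 / (n + q)`. -/
theorem lintegral_rpow_density_lt_top {n : ℕ} {q : ℝ} (hq : 1 < q) {p : En n → NNReal}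
    (hp : Measurable p) [IsProbabilityMeasure (volume.withDensity fun x => (p x : ℝ≥0∞))]
    (h1 : P1 (volume.withDensity fun x => (p x : ℝ≥0∞))) :
    ∫⁻ x, ENNReal.ofReal ((p x : ℝ) ^ (1 - 1/((n : ℝ) + q)) / (1 - 1/((n : ℝ) + q))) < ⊤ := by
  have hs : 1 < (n : ℝ) + q := by linarith [(Nat.cast_nonneg n : (0 : ℝ) ≤ n)]
  have hs0 : 0 < (n : ℝ) + q := by linarith
  set s := (n : ℝ) + q with hsdef
  have hinv : 0 < 1 / s := by positivity
  have hα : 0 < 1 - 1 / s := by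
    rw [sub_pos, div_lt_one hs0]
    exact hs
  have hmom : Integrable (fun x : En n => (p x : ℝ) * (1 + ‖x‖)) := by
    have : Integrable (fun x : En n => 1 + ‖x‖) (volume.withDensity fun x => (p x : ℝ≥0∞)) :=
      (integrable_const 1).add h1
    exact (integrable_withDensity_iff_integrable_smul hp).1 this
  have hjap : Integrable (fun x : En n => (1 + ‖x‖) ^ (-(s - 1))) := by
    refine integrable_one_add_norm ?_
    rw [finrank_euclideanSpace_fin]
    linarith
  refine lt_of_le_of_lt (lintegral_mono fun x => ENNReal.ofReal_le_ofReal ?_)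
    (((hmom.const_mul (1 - 1 / s)).add (hjap.const_mul (1 / s))).div_const
      (1 - 1 / s)).lintegral_lt_top
  refine div_le_div_of_nonneg_right ?_ hα.le
  have hw : (0 : ℝ) < 1 + ‖x‖ := by positivity
  have := Real.geom_mean_le_arith_mean2_weighted hα.le hinv.le
    (show (0 : ℝ) ≤ p x * (1 + ‖x‖) by positivity)
    (show (0 : ℝ) ≤ (1 + ‖x‖) ^ (-(s - 1)) by positivity) (by ring)
  refine le_trans (le_of_eq ?_) this
  rw [Real.mul_rpow (by positivity) hw.le, ← Real.rpow_mul hw.le, mul_assoc, ← Real.rpow_add hw]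
  have : 1 - 1 / s + -(s - 1) * (1 / s) = 0 := by field_simp; ring
  rw [this, Real.rpow_zero, mul_one]

/-- Quantitative strict concavity of the power integral under averaging with a translate. -/
theorem exists_lintegral_rpow_add_volume_le {n : ℕ} {α : ℝ} (hα0 : 0 < α) (hα1 : α < 1)
    {p : En n → NNReal} (hp : Measurable p) {c : NNReal} (hc : 0 < c) :
    ∃ k : ℝ, 0 < k ∧ ∀ v : En n,
      (∫⁻ x, ENNReal.ofReal ((p x : ℝ) ^ α / α)) +
        ENNReal.ofReal k * volume {y | p y = 0 ∧ c ≤ p (y - v)} ≤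
      ∫⁻ x, ENNReal.ofReal ((((p x + p (x - v)) / 2 : NNReal) : ℝ) ^ α / α) := by
  have h2 : (0 : ℝ) < (1 / 2) ^ α - 1 / 2 := by
    rw [sub_pos]
    simpa using Real.rpow_lt_rpow_of_exponent_gt (x := 1 / 2) (by norm_num) (by norm_num) hα1
  have hcpos : (0 : ℝ) < c := by exact_mod_cast hc
  refine ⟨((1 / 2) ^ α - 1 / 2) * c ^ α / α, by positivity, fun v => ?_⟩
  set k := ((1 / 2) ^ α - 1 / 2) * (c : ℝ) ^ α / α with hk
  have hkpos : 0 < k := by positivity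
  set V := {y | p y = 0 ∧ c ≤ p (y - v)} with hV
  have hVm : MeasurableSet V :=
    (measurableSet_eq_fun hp measurable_const).inter
      (measurableSet_le measurable_const (by fun_prop))
  have hpt : ∀ x, ((p x : ℝ) ^ α / α) / 2 + ((p (x - v) : ℝ) ^ α / α) / 2 +
      V.indicator (fun _ => k) x ≤ (((p x + p (x - v)) / 2 : NNReal) : ℝ) ^ α / α := by
    intro x
    push_cast
    by_cases hx : x ∈ V
    · rw [Set.indicator_of_mem hx, hx.1]
      have hcp : (c : ℝ) ≤ p (x - v) := by exact_mod_cast hx.2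
      have hle : (c : ℝ) ^ α ≤ (p (x - v) : ℝ) ^ α := by gcongr
      rw [NNReal.coe_zero, Real.zero_rpow hα0.ne', zero_add, zero_div, zero_div, zero_add,
        div_eq_mul_one_div (p (x - v) : ℝ) 2, Real.mul_rpow (by positivity) (by norm_num)]
      calc _ ≤ (p (x - v) : ℝ) ^ α / α / 2 + ((1 / 2) ^ α - 1 / 2) * (p (x - v) : ℝ) ^ α / α := by
            rw [hk]; gcongr
        _ = _ := by ring
    · rw [Set.indicator_of_notMem hx, add_zero]
      have := (Real.concaveOn_rpow hα0.le hα1.le).2 (Set.mem_Ici.2 (p x).coe_nonneg)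
        (Set.mem_Ici.2 (p (x - v)).coe_nonneg) (show (0 : ℝ) ≤ 1 / 2 by norm_num)
        (show (0 : ℝ) ≤ 1 / 2 by norm_num) (by norm_num)
      simp only [smul_eq_mul] at this
      rw [← add_div, ← add_div, div_right_comm]
      refine div_le_div_of_nonneg_right ?_ hα0.le
      calc _ = 1 / 2 * (p x : ℝ) ^ α + 1 / 2 * (p (x - v) : ℝ) ^ α := by ring
        _ ≤ _ := this
        _ = _ := by congr 1; ring
  have hm : Measurable fun x => ENNReal.ofReal ((p x : ℝ) ^ α / α) := by fun_prop
  calc _ = (∫⁻ x, ENNReal.ofReal ((p x : ℝ) ^ α / α) / 2) +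
        (∫⁻ x, ENNReal.ofReal ((p (x - v) : ℝ) ^ α / α) / 2) +
        ∫⁻ x, V.indicator (fun _ => ENNReal.ofReal k) x := by
        rw [lintegral_indicator_const hVm,
          lintegral_sub_right_eq_self (fun x => ENNReal.ofReal ((p x : ℝ) ^ α / α) / 2) v]
        simp only [ENNReal.div_eq_inv_mul]
        rw [lintegral_const_mul _ hm, ← add_mul, ENNReal.inv_two_add_inv_two, one_mul]
    _ = ∫⁻ x, (ENNReal.ofReal ((p x : ℝ) ^ α / α) / 2 +
        ENNReal.ofReal ((p (x - v) : ℝ) ^ α / α) / 2 +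
        V.indicator (fun _ => ENNReal.ofReal k) x) := by
        rw [lintegral_add_left (by fun_prop), lintegral_add_left (by fun_prop)]
    _ ≤ _ := by
        refine lintegral_mono fun x => le_trans (le_of_eq ?_) (ENNReal.ofReal_le_ofReal (hpt x))
        have hind : 0 ≤ V.indicator (fun _ => k) x := Set.indicator_nonneg (fun _ _ => hkpos.le) x
        rw [ENNReal.ofReal_add (by positivity) hind, ENNReal.ofReal_add (by positivity)
          (by positivity), ENNReal.ofReal_div_of_pos two_pos, ENNReal.ofReal_div_of_pos two_pos]
        congr 1
        · simp
        · by_cases hx : x ∈ V <;> simp [hx]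

theorem Tcorr_dirac_zero_le {n : ℕ} (μ : Measure (En n)) : Tcorr (Measure.dirac 0) μ ≤ 0 := by
  refine iSup₂_le fun γ hγ => le_of_eq ?_
  have h0 : (fun p : En n × En n => ⟪p.1, p.2⟫) =ᵐ[γ] 0 := by
    have : ∀ᵐ x ∂(γ.map Prod.fst), x = 0 := by
      rw [hγ.2.1, ae_dirac_eq]
      simp
    filter_upwards [ae_of_ae_map measurable_fst.aemeasurable this] with p hp
    simp [hp]
  rw [eInt_coe_of_integrable ((integrable_zero _ _ _).congr h0.symm), integral_congr_ae h0]
  simp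

theorem Tcorr_ne_bot {n : ℕ} {ρ μ : Measure (En n)} [IsProbabilityMeasure ρ]
    [IsProbabilityMeasure μ] (hρ : P1 ρ) (hμ : P1 μ) : Tcorr ρ μ ≠ ⊥ := by
  have hint : Integrable (fun p : En n × En n => ⟪p.1, p.2⟫) (ρ.prod μ) :=
    (Integrable.mul_prod hρ hμ).mono' (by fun_prop)
      (Eventually.of_forall fun p => norm_inner_le_norm _ _)
  have hmem : ρ.prod μ ∈ Plans ρ μ := ⟨inferInstance, by simp, by simp⟩
  refine ne_bot_of_le_ne_bot ?_ (le_iSup₂_of_le _ hmem le_rfl)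
  rw [eInt_coe_of_integrable hint]
  exact EReal.coe_ne_bot _

theorem Tcorr_ne_top_of_isMinimizer {n : ℕ} {q : ℝ} (hq : 1 < q) {μ : Measure (En n)}
    {p : En n → NNReal} (hp : Measurable p)
    [IsProbabilityMeasure (volume.withDensity fun x => (p x : ℝ≥0∞))]
    (h1 : P1 (volume.withDensity fun x => (p x : ℝ≥0∞)))
    (hmin : ∀ ρ : Measure (En n), IsProbabilityMeasure ρ → P1 ρ →
      Jfun n q μ (volume.withDensity fun x => (p x : ℝ≥0∞)) ≤ Jfun n q μ ρ) :
    Tcorr (volume.withDensity fun x => (p x : ℝ≥0∞)) μ ≠ ⊤ := by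
  intro htop
  have hdirac : P1 (Measure.dirac (0 : En n)) := integrable_dirac (by simp)
  have hle := hmin _ inferInstance hdirac
  have hF : Ffun n q (Measure.dirac (0 : En n)) ≤ 0 := by
    rw [Ffun, EReal.neg_le_zero]
    exact EReal.coe_ennreal_nonneg _
  have h0 : Jfun n q μ (Measure.dirac (0 : En n)) ≤ 0 :=
    (add_le_add hF (Tcorr_dirac_zero_le μ)).trans_eq (zero_add 0)
  have hI := lintegral_rpow_density_lt_top hq hp h1
  rw [Jfun, htop, Ffun_withDensity q hp, EReal.add_top_of_ne_bot (by simpa using hI.ne)] at hle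
  exact absurd (hle.trans h0) (by simp)

/-- The zero set of the density of a minimizer has small overlap with the translates of its
superlevel sets. -/
theorem volume_layer_le_of_isMinimizer {n : ℕ} {q : ℝ} (hq : 1 < q)
    {μ : Measure (En n)} [IsProbabilityMeasure μ] (hμ : P1 μ) (hbar : ∫ y, y ∂μ = (0 : En n))
    {p : En n → NNReal} (hp : Measurable p)
    [IsProbabilityMeasure (volume.withDensity fun x => (p x : ℝ≥0∞))]
    (h1 : P1 (volume.withDensity fun x => (p x : ℝ≥0∞)))
    (hmin : ∀ ρ : Measure (En n), IsProbabilityMeasure ρ → P1 ρ →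
      Jfun n q μ (volume.withDensity fun x => (p x : ℝ≥0∞)) ≤ Jfun n q μ ρ)
    {c : NNReal} (hc : 0 < c) {ε : ℝ} (hε : 0 < ε) :
    ∃ δ > 0, ∀ v : En n, ‖v‖ < δ →
      volume {y | p y = 0 ∧ c ≤ p (y - v)} ≤ ENNReal.ofReal (ε * ‖v‖) := by
  have hs : 1 < (n : ℝ) + q := by linarith [(Nat.cast_nonneg n : (0 : ℝ) ≤ n)]
  have hα0 : 0 < 1 - 1 / ((n : ℝ) + q) := by
    rw [sub_pos, div_lt_one (by linarith)]
    exact hs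
  have hα1 : 1 - 1 / ((n : ℝ) + q) < 1 := by
    have : 0 < 1 / ((n : ℝ) + q) := by positivity
    linarith
  have htop := Tcorr_ne_top_of_isMinimizer hq hp h1 hmin
  have hbot : Tcorr (volume.withDensity fun x => (p x : ℝ≥0∞)) μ ≠ ⊥ := Tcorr_ne_bot h1 hμ
  obtain ⟨k, hk, hgain⟩ := exists_lintegral_rpow_add_volume_le hα0 hα1 hp hc
  obtain ⟨δ, hδ, hcost⟩ := Tcorr_avgTranslate_le hμ hbar hp htop (mul_pos hk hε)
  refine ⟨δ, hδ, fun v hv => ?_⟩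
  have hI := lintegral_rpow_density_lt_top hq hp h1
  have hp' : Measurable fun x => (p x + p (x - v)) / 2 := by fun_prop
  have h1' := h1.avgTranslate v
  have hle := hmin _ (isProbabilityMeasure_avgTranslate _ v) h1'
  have hprob := isProbabilityMeasure_avgTranslate (volume.withDensity fun x => (p x : ℝ≥0∞)) v
  have hcost' := hcost v hv
  have hF' := (congrArg (Ffun n q) (avgTranslate_withDensity hp v)).trans
    (Ffun_withDensity q hp')
  rw [Jfun, Jfun, hF', Ffun_withDensity q hp] at hle
  rw [avgTranslate_withDensity hp v] at h1' hprob
  have hI' := lintegral_rpow_density_lt_top hq hp' h1'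
  have hgain' := hgain v
  set I := ∫⁻ x, ENNReal.ofReal
    ((p x : ℝ) ^ (1 - 1/((n : ℝ) + q)) / (1 - 1/((n : ℝ) + q)))
  set I' := ∫⁻ x, ENNReal.ofReal ((((p x + p (x - v)) / 2 : NNReal) : ℝ) ^
    (1 - 1/((n : ℝ) + q)) / (1 - 1/((n : ℝ) + q)))
  lift Tcorr (volume.withDensity fun x => (p x : ℝ≥0∞)) μ to ℝ using ⟨htop, hbot⟩ with T
  have hreal : I'.toReal ≤ I.toReal + k * (ε * ‖v‖) := by
    have h := hle.trans (add_le_add_right hcost' _)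
    rw [← EReal.coe_ennreal_toReal hI.ne, ← EReal.coe_ennreal_toReal hI'.ne, ← EReal.coe_neg,
      ← EReal.coe_neg] at h
    norm_cast at h
    linarith
  have hI'le : I' ≤ I + ENNReal.ofReal k * ENNReal.ofReal (ε * ‖v‖) := by
    rw [← ENNReal.ofReal_toReal hI.ne, ← ENNReal.ofReal_mul hk.le, ← ENNReal.ofReal_add
      ENNReal.toReal_nonneg (by positivity), ← ENNReal.ofReal_toReal hI'.ne]
    exact ENNReal.ofReal_le_ofReal hreal
  have hmul := (ENNReal.add_le_add_iff_left hI.ne).1 (hgain'.trans hI'le)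
  exact (ENNReal.mul_le_mul_iff_right (by simpa using hk) ENNReal.ofReal_ne_top).1 hmul

theorem ConvexLSC.convex_sublevel {n : ℕ} {φ : En n → EReal} (hφ : ConvexLSC φ) (M : ℝ) :
    Convex ℝ {x | φ x ≤ M} := by
  intro x hx y hy a b ha hb hab
  have := hφ.2 (x := (x, M)) hx (y := (y, M)) hy ha hb hab
  simpa [← add_mul, hab] using this

theorem exists_nat_le_of_ne_top {x : EReal} (hx : x ≠ ⊤) : ∃ k : ℕ, x ≤ ((k : ℝ) : EReal) := by
  obtain ⟨k, hk⟩ := exists_nat_ge x.toReal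
  exact ⟨k, (EReal.le_coe_toReal hx).trans (by exact_mod_cast hk)⟩

theorem ConvexLSC.convex_lt_top {n : ℕ} {φ : En n → EReal} (hφ : ConvexLSC φ) :
    Convex ℝ {x | φ x < ⊤} := by
  have hU : {x | φ x < ⊤} = ⋃ k : ℕ, {x | φ x ≤ ((k : ℝ) : EReal)} := by
    ext x
    simp only [mem_ofPred_eq, mem_iUnion]
    exact ⟨fun h => exists_nat_le_of_ne_top h.ne, fun ⟨k, hk⟩ => hk.trans_lt (EReal.coe_lt_top _)⟩
  rw [hU]
  refine Directed.convex_iUnion (directed_of_isDirected_le fun i j hij x hx => ?_)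
    fun k => hφ.convex_sublevel k
  exact (show φ x ≤ _ from hx).trans (by exact_mod_cast hij)

/-- A sublevel set of `φ` has nonempty interior as soon as `φ` is finite on a set of positive
measure. -/
theorem ConvexLSC.exists_ball_subset_sublevel {n : ℕ} {φ : En n → EReal} (hφ : ConvexLSC φ)
    (hpos : volume {x | φ x < ⊤} ≠ 0) :
    ∃ (M : ℕ) (z : En n) (r : ℝ), 0 < r ∧ Metric.ball z r ⊆ {x | φ x ≤ ((M : ℝ) : EReal)} := by
  have : ∃ M : ℕ, volume {x | φ x ≤ ((M : ℝ) : EReal)} ≠ 0 := by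
    by_contra! h
    refine hpos (measure_mono_null (fun x hx => ?_) (measure_iUnion_null h))
    exact mem_iUnion.2 (exists_nat_le_of_ne_top (ne_of_lt hx))
  obtain ⟨M, hM⟩ := this
  have hint : (interior {x | φ x ≤ ((M : ℝ) : EReal)}).Nonempty := by
    rw [nonempty_iff_ne_empty]
    intro he
    refine hM (measure_mono_null (subset_closure.trans ?_)
      ((hφ.convex_sublevel M).addHaar_frontier volume))
    rw [frontier, he, sdiff_empty]
  obtain ⟨z, hz⟩ := hint
  obtain ⟨r, hr, hball⟩ := Metric.isOpen_iff.1 isOpen_interior z hz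
  exact ⟨M, z, r, hr, hball.trans interior_subset⟩

/-- The precise representative `φ^{-(n+q)}` of the density of a
minimizer vanishes `H^{n-1}`-a.e. on the boundary of `Ω = {φ < +∞}`. -/
theorem qMomentMeasures_density_vanishes_on_boundary
    (n : ℕ) (hn : 1 ≤ n) (q : ℝ) (hq : 1 < q)
    (μ : Measure (En n)) [IsProbabilityMeasure μ]
    (hμ1 : P1 μ) (hbar : ∫ y, y ∂μ = (0 : En n)) (hplane : NotHyperplane μ)
    (φ : En n → EReal) (hφpos : ∀ x, 0 < φ x) (hφ : ConvexLSC φ)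
    (ρbar : Measure (En n))
    (hρdef : ρbar = volume.withDensity (fun x => posPartNN (φ x) ^ (-((n : ℝ) + q))))
    [IsProbabilityMeasure ρbar] (hρ1 : P1 ρbar)
    (hmin : ∀ ρ : Measure (En n), IsProbabilityMeasure ρ → P1 ρ →
      Jfun n q μ ρbar ≤ Jfun n q μ ρ) :
    Measure.hausdorffMeasure ((n : ℝ) - 1)
      {x | x ∈ frontier {y : En n | φ y < ⊤} ∧ φ x ≠ ⊤} = 0 := by
  have hs : 0 < (n : ℝ) + q := by linarith [(Nat.cast_nonneg n : (0 : ℝ) ≤ n)]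
  have hne0 : ∀ x, posPartNN (φ x) ≠ 0 := fun x => by
    have hx := hφpos x
    unfold posPartNN
    split_ifs with h
    · exact ENNReal.top_ne_zero
    · simpa using EReal.toReal_pos hx h
  set p : En n → NNReal := fun x => (posPartNN (φ x) ^ (-((n : ℝ) + q))).toNNReal
  have hpcoe : ∀ x, (p x : ℝ≥0∞) = posPartNN (φ x) ^ (-((n : ℝ) + q)) := fun x => by
    refine ENNReal.coe_toNNReal ?_
    rw [ENNReal.rpow_neg, ENNReal.inv_ne_top]
    exact (ENNReal.rpow_pos_of_nonneg (pos_iff_ne_zero.2 (hne0 x)) hs.le).ne'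
  have hpm : Measurable p := by
    have h1 : Measurable fun x => posPartNN (φ x) := hφ.1.measurable.ereal_toENNReal
    exact (h1.pow_const _).ennreal_toNNReal
  have hp0 : ∀ x, ¬ φ x < ⊤ → p x = 0 := fun x hx => by
    rw [← ENNReal.coe_eq_zero, hpcoe, posPartNN, if_pos (not_lt_top_iff.1 hx),
      ENNReal.top_rpow_of_neg (neg_neg_of_pos hs)]
  have hpc : ∀ (M : ℕ) (x : En n), φ x ≤ ((M : ℝ) : EReal) →
      ((M : NNReal) ^ (-((n : ℝ) + q))) ≤ p x := by
    intro M x hx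
    have hxt : φ x ≠ ⊤ := (hx.trans_lt (EReal.coe_lt_top _)).ne
    have hxM : posPartNN (φ x) ≤ M := by
      rw [posPartNN, if_neg hxt, ← ENNReal.ofReal_natCast]
      exact ENNReal.ofReal_le_ofReal
        (EReal.toReal_le_toReal hx (hφpos x).ne_bot (EReal.coe_ne_top _))
    have hM : (M : NNReal) ≠ 0 := fun h0 => by
      rw [Nat.cast_eq_zero.1 h0] at hxM
      exact hne0 x (by simpa using hxM)
    rw [← ENNReal.coe_le_coe, hpcoe, ENNReal.coe_rpow_of_ne_zero hM, ENNReal.rpow_neg,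
      ENNReal.rpow_neg, ENNReal.inv_le_inv]
    exact ENNReal.rpow_le_rpow (by simpa using hxM) hs.le
  obtain rfl : ρbar = volume.withDensity fun x => (p x : ℝ≥0∞) := by
    simp only [hρdef, hpcoe]
  have hvol : volume {x | φ x < ⊤} ≠ 0 := fun h0 => by
    have hp_ae : (fun x => (p x : ℝ≥0∞)) =ᵐ[volume] 0 := by
      filter_upwards [measure_eq_zero_iff_ae_notMem.1 h0] with x hx
      simp [hp0 x hx]
    have := measure_univ (μ := volume.withDensity fun x => (p x : ℝ≥0∞))
    rw [withDensity_congr_ae hp_ae] at this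
    simp at this
  obtain ⟨M₀, z, r, hr, hball⟩ := hφ.exists_ball_subset_sublevel hvol
  set Ω := {y : En n | φ y < ⊤} with hΩ
  have hnull : ∀ k : ℕ, Measure.hausdorffMeasure ((n : ℝ) - 1)
      (frontier Ω ∩ {x | φ x ≤ (((M₀ + k : ℕ) : ℝ) : EReal)}) = 0 := by
    intro k
    have hM0 : (M₀ : ℝ) ≤ ((M₀ + k : ℕ) : ℝ) := by
      push_cast; linarith [(Nat.cast_nonneg k : (0 : ℝ) ≤ k)]
    set M := M₀ + k with hM
    have hMball : Metric.ball z r ⊆ {x | φ x ≤ ((M : ℝ) : EReal)} := fun x hx =>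
      (hball hx).trans (EReal.coe_le_coe_iff.2 hM0)
    have hMpos : 0 < M := by
      have := (hφpos z).trans_le (hMball (Metric.mem_ball_self hr))
      exact_mod_cast this
    have hc : (0 : NNReal) < (M : NNReal) ^ (-((n : ℝ) + q)) :=
      NNReal.rpow_pos (by exact_mod_cast hMpos)
    refine measure_null_of_locally_null _ fun x₀ _ => ?_
    refine ⟨_, inter_mem self_mem_nhdsWithin
      (mem_nhdsWithin_of_mem_nhds (Metric.ball_mem_nhds x₀ (half_pos hr))), ?_⟩
    refine hausdorffMeasure_eq_zero_of_volume_layer_le hn hφ.convex_lt_top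
      (hφ.convex_sublevel M) (fun x hx => lt_of_le_of_lt hx (EReal.coe_lt_top _)) hr hMball
      (fun x hx => hx.1.1) (fun x hx => hx.1.2) (fun x hx => hx.2) fun ε hε => ?_
    have he : (0 : ℝ) < ‖x₀ - z‖ + 1 := by positivity
    obtain ⟨δ, hδ, hδV⟩ := volume_layer_le_of_isMinimizer hq hμ1 hbar hpm hρ1 hmin hc
      (div_pos hε he)
    refine ⟨δ / (‖x₀ - z‖ + 1), by positivity, fun h hh hhδ => ?_⟩
    have hnorm : ‖h • (x₀ - z)‖ = h * ‖x₀ - z‖ := by rw [norm_smul, Real.norm_of_nonneg hh.le]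
    have hlt : ‖h • (x₀ - z)‖ < δ := by
      rw [lt_div_iff₀ he] at hhδ
      rw [hnorm]
      linarith
    refine (measure_mono fun y hy => ?_).trans
      ((hδV _ hlt).trans (ENNReal.ofReal_le_ofReal ?_))
    · exact ⟨hp0 y hy.1, hpc M _ hy.2⟩
    · rw [hnorm, div_mul_eq_mul_div, div_le_iff₀ he, mul_assoc]
      gcongr
      linarith
  refine measure_mono_null (fun x hx => ?_) (measure_iUnion_null hnull)
  obtain ⟨k, hk⟩ := exists_nat_le_of_ne_top hx.2
  refine mem_iUnion.2 ⟨k, hx.1, hk.trans (EReal.coe_le_coe_iff.2 ?_)⟩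
  push_cast
  linarith [(Nat.cast_nonneg M₀ : (0 : ℝ) ≤ M₀)]

end
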